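/- Let p and q be distinct odd primes, and let G be a finite group of minimal order with respect to the property that G contains an element whose order is divisible by p·q but every element of G \ Frat(G) has order divisible by some prime other than p and q (i.e., Ω_{p,q}(G) ≠ ∅ and Ω**_{p,q}(G) = ∅). Then the Sylow p-subgroups and the Sylow q-subgroups of G/Frat(G) are cyclic. -/

import Mathlib

/-- `Ω_{p,q}(G) ≠ ∅` and `Ω**_{p,q}(G) = ∅`: `G` has an element of order divisible by
`p·q`, but every element of `G` whose order is divisible by `p·q` and by no prime other
than `p` and `q` lies in the Frattini subgroup. -/
def OmegaBad (p q : ℕ) (G : Type*) [Group G] : Prop :=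
  (∃ g : G, p * q ∣ orderOf g) ∧
    ∀ g : G, (p * q ∣ orderOf g ∧ ∀ r : ℕ, r.Prime → r ∣ orderOf g → r = p ∨ r = q) →
      g ∈ frattini G

open Finset in
/-- If `z` has order dividing `p` and every point of `A` of exponent `q` fixed by `z` is trivial,
then the norm of such points along the powers of `z` vanishes. -/
theorem prod_range_pow_eq_one_of_fixedPointFree {K A : Type*} [Group K] [CommGroup A]
    (φ : K →* MulAut A) {p q : ℕ} {z : K} (hz : z ^ p = 1)
    (hfree : ∀ w : A, w ^ q = 1 → φ z w = w → w = 1) {v : A} (hv : v ^ q = 1) :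
    ∏ i ∈ range p, φ (z ^ i) v = 1 := by
  apply hfree
  · rw [← prod_pow]
    exact prod_eq_one fun i _ => by rw [← map_pow, hv, map_one]
  · rw [map_prod]
    have h : ∀ i, φ z (φ (z ^ i) v) = φ (z ^ (i + 1)) v := fun i => by
      rw [pow_succ', map_mul, MulAut.mul_apply]
    simp only [h]
    have h1 := prod_range_succ (fun i => φ (z ^ i) v) p
    rw [prod_range_succ'] at h1
    simpa [hz] using h1

open Finset in
/-- A group acting fixed-point-freely on the elements of order `q` of an abelian group has no
subgroup of type `(p, p)`. -/
theorem mem_zpowers_of_commute_of_fixedPointFree {K A : Type*} [Group K] [CommGroup A]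
    (φ : K →* MulAut A) {p q : ℕ} (hp : p.Prime) (hq : q.Prime) (hpq : p ≠ q)
    (hfree : ∀ z : K, z ^ p = 1 → z ≠ 1 → ∀ w : A, w ^ q = 1 → φ z w = w → w = 1)
    {v : A} (hv : v ^ q = 1) (hv1 : v ≠ 1)
    {x y : K} (hxy : Commute x y) (hx : x ^ p = 1) (hy : y ^ p = 1) (hy1 : y ≠ 1) :
    x ∈ Subgroup.zpowers y := by
  have := Fact.mk hp
  by_contra hxy'
  have hyi : ∀ i ∈ range p, i ≠ 0 → y ^ i ≠ 1 := by
    intro i hi hi0 h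
    have := orderOf_dvd_of_pow_eq_one h
    rw [orderOf_eq_prime hy hy1] at this
    exact absurd (Nat.le_of_dvd (Nat.pos_of_ne_zero hi0) this) (by simpa using hi)
  have h1 : ∏ j ∈ range p, ∏ i ∈ range p, φ ((x * y ^ j) ^ i) v = 1 := by
    refine prod_eq_one fun j _ => ?_
    have hz : (x * y ^ j) ^ p = 1 := by
      rw [(hxy.pow_right j).mul_pow, hx, ← pow_mul, mul_comm, pow_mul, hy, one_pow, one_mul]
    refine prod_range_pow_eq_one_of_fixedPointFree φ hz (hfree _ hz fun h => hxy' ?_) hv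
    rw [eq_inv_of_mul_eq_one_left h]
    exact inv_mem (pow_mem (Subgroup.mem_zpowers y) j)
  rw [prod_comm, prod_eq_single_of_mem 0 (by simp [hp.pos])] at h1
  · simp only [pow_zero, map_one, MulAut.one_apply, prod_const, card_range] at h1
    apply hv1
    have := Nat.Coprime.gcd_eq_one ((Nat.coprime_primes hp hq).2 hpq)
    rw [← orderOf_eq_one_iff, ← Nat.dvd_one, ← this]
    exact Nat.dvd_gcd (orderOf_dvd_of_pow_eq_one h1) (orderOf_dvd_of_pow_eq_one hv)
  · intro i hi hi0
    have h : ∀ j, φ ((x * y ^ j) ^ i) v = φ (x ^ i) (φ ((y ^ i) ^ j) v) := fun j => by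
      rw [(hxy.pow_right j).mul_pow, map_mul, MulAut.mul_apply, ← pow_mul, ← pow_mul, mul_comm i j]
    simp only [h]
    have hz : (y ^ i) ^ p = 1 := by rw [← pow_mul, mul_comm, pow_mul, hy, one_pow]
    rw [← map_prod, prod_range_pow_eq_one_of_fixedPointFree φ hz (hfree _ hz (hyi i hi hi0)) hv,
      map_one]

/-- A nontrivial normal subgroup of a nilpotent group meets the center nontrivially. -/
theorem exists_ne_one_mem_inf_center {H : Type*} [Group H] [Group.IsNilpotent H]
    (N : Subgroup H) [N.Normal] (hN : N ≠ ⊥) : ∃ v ∈ N, v ∈ Subgroup.center H ∧ v ≠ 1 := by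
  classical
  obtain ⟨n, hn⟩ := Group.IsNilpotent.nilpotent H
  have hex : ∃ n, N ⊓ Subgroup.upperCentralSeries H n ≠ ⊥ := ⟨n, by rwa [hn, inf_top_eq]⟩
  obtain ⟨⟨v, hvN, hvZ⟩, hv1⟩ := Subgroup.ne_bot_iff_exists_ne_one.1 (Nat.find_spec hex)
  replace hv1 : v ≠ 1 := fun h => hv1 (Subtype.ext h)
  obtain ⟨k, hk⟩ : ∃ k, Nat.find hex = k + 1 := Nat.exists_eq_succ_of_ne_zero fun h0 => by
    rw [h0] at hvZ
    exact hv1 (by simpa using hvZ)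
  rw [hk] at hvZ
  refine ⟨v, hvN, Subgroup.mem_center_iff.2 fun g => ?_, hv1⟩
  have h1 := Subgroup.mem_upperCentralSeries_succ_iff.1 hvZ g
  have h2 : v * g * v⁻¹ * g⁻¹ ∈ N := by
    simpa [mul_assoc] using mul_mem hvN (‹N.Normal›.conj_mem _ (inv_mem hvN) g)
  have h3 : N ⊓ Subgroup.upperCentralSeries H k = ⊥ := by
    by_contra h
    exact Nat.find_min hex (by omega) h
  have h4 : v * g * v⁻¹ * g⁻¹ ∈ N ⊓ Subgroup.upperCentralSeries H k := ⟨h2, h1⟩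
  rw [h3, Subgroup.mem_bot] at h4
  have := mul_inv_eq_iff_eq_mul.1 (mul_inv_eq_one.1 h4)
  exact this.symm

/-- A prime dividing the order of a finite nilpotent group divides the order of its center. -/
theorem exists_mem_center_pow_prime_eq_one {H : Type*} [Group H] [Finite H] [Group.IsNilpotent H]
    {q : ℕ} (hq : q.Prime) (hdvd : q ∣ Nat.card H) :
    ∃ v ∈ Subgroup.center H, v ^ q = 1 ∧ v ≠ 1 := by
  have := Fact.mk hq
  let Q : Sylow q H := default
  have : (Q : Subgroup H).Normal :=
    Group.isNilpotent_of_finite_tfae.out 0 3 rfl rfl |>.mp ‹_› q ‹_› Q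
  obtain ⟨v, hvQ, hvZ, hv1⟩ := exists_ne_one_mem_inf_center (Q : Subgroup H)
    (Q.ne_bot_of_dvd_card hdvd)
  obtain ⟨k, hk⟩ := (IsPGroup.iff_orderOf.1 Q.isPGroup') ⟨v, hvQ⟩
  rw [Subgroup.orderOf_mk] at hk
  have hk0 : k ≠ 0 := by
    rintro rfl
    exact hv1 (orderOf_eq_one_iff.1 (by simpa using hk))
  have hdv : q ∣ orderOf v := hk ▸ dvd_pow_self q hk0
  have hord := orderOf_pow_orderOf_div (orderOf_pos v).ne' hdv
  refine ⟨v ^ (orderOf v / q), pow_mem hvZ _, ?_, ?_⟩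
  · simpa [hord] using pow_orderOf_eq_one (v ^ (orderOf v / q))
  · intro h
    rw [h, orderOf_one] at hord
    exact hq.one_lt.ne hord

/-- If `p ^ (n + 1) ∣ m ^ p - 1` with `p` an odd prime, then `p` and `p ^ n` divide `m - 1`. -/
theorem Int.dvd_sub_one_of_pow_dvd_pow_sub_one {p : ℕ} (hp : p.Prime) (hodd : Odd p) {n : ℕ}
    {m : ℤ} (h : (p : ℤ) ^ (n + 1) ∣ m ^ p - 1) : (p : ℤ) ∣ m - 1 ∧ (p : ℤ) ^ n ∣ m - 1 := by
  have := Fact.mk hp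
  have h1 : (p : ℤ) ∣ m - 1 := by
    have h2 : (p : ℤ) ∣ m ^ p - 1 := (dvd_pow_self _ n.succ_ne_zero).trans h
    rw [← ZMod.intCast_zmod_eq_zero_iff_dvd] at h2 ⊢
    simpa [ZMod.pow_card] using h2
  refine ⟨h1, ?_⟩
  have hm : ¬ (p : ℤ) ∣ m := fun hm =>
    (Nat.prime_iff_prime_int.1 hp).not_isUnit (isUnit_of_dvd_one (by simpa using dvd_sub hm h1))
  have h3 := Int.emultiplicity_pow_sub_pow hp hodd h1 hm p
  rw [one_pow, hp.emultiplicity_self] at h3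
  rw [pow_dvd_iff_le_emultiplicity, h3] at h
  rw [pow_dvd_iff_le_emultiplicity]
  push_cast at h
  exact (ENat.add_le_add_iff_right (by simp)).1 h

/-- If `m ≡ 1` modulo `p` and modulo `p ^ n`, then `1 + m + ⋯ + m ^ (p - 1) ≡ p` modulo
`p ^ (n + 1)`, for `p` odd. -/
theorem Int.pow_succ_dvd_geom_sum_sub {p : ℕ} (hodd : Odd p) {n : ℕ} {m : ℤ}
    (h1 : (p : ℤ) ∣ m - 1) (h2 : (p : ℤ) ^ n ∣ m - 1) :
    (p : ℤ) ^ (n + 1) ∣ (∑ i ∈ Finset.range p, m ^ i) - p := by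
  have hsq : (p : ℤ) ^ (n + 1) ∣ (m - 1) * (m - 1) := pow_succ (p : ℤ) n ▸ mul_dvd_mul h2 h1
  have hpow : ∀ j : ℕ, (p : ℤ) ^ (n + 1) ∣ m ^ j - 1 - j * (m - 1) := by
    intro j
    induction j with
    | zero => simp
    | succ j ih =>
      have : m ^ (j + 1) - 1 - (j + 1 : ℕ) * (m - 1) =
          m * (m ^ j - 1 - j * (m - 1)) + j * ((m - 1) * (m - 1)) := by
        push_cast; ring
      rw [this]
      exact dvd_add (ih.mul_left _) (hsq.mul_left _)
  have hsum : ∀ j : ℕ, (p : ℤ) ^ (n + 1) ∣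
      2 * ((∑ i ∈ Finset.range j, m ^ i) - j) - (m - 1) * (j * (j - 1)) := by
    intro j
    induction j with
    | zero => simp
    | succ j ih =>
      rw [Finset.sum_range_succ]
      refine (dvd_add ih ((hpow j).mul_left 2)).trans (dvd_of_eq ?_)
      push_cast; ring
  have h3 : (p : ℤ) ^ (n + 1) ∣ (m - 1) * (p * (p - 1)) := by
    rw [pow_succ]
    exact mul_dvd_mul h2 (dvd_mul_right _ _)
  have h4 : IsCoprime ((p : ℤ) ^ (n + 1)) 2 := by
    refine IsCoprime.pow_left ?_
    exact_mod_cast Nat.isCoprime_iff_coprime.2 hodd.coprime_two_right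
  exact h4.dvd_of_dvd_mul_left ((dvd_sub_left h3).1 (hsum p))

/-- Powers of `x ^ a * y` when `y` normalizes `⟨x⟩`. -/
theorem zpow_mul_pow_eq_of_conj_eq_zpow {K : Type*} [Group K] {x y : K} {m : ℤ}
    (h : ∀ a : ℤ, y * x ^ a = x ^ (m * a) * y) (a : ℤ) (j : ℕ) :
    (x ^ a * y) ^ j = x ^ (a * ∑ i ∈ Finset.range j, m ^ i) * y ^ j := by
  induction j with
  | zero => simp
  | succ j ih =>
    have hsum : a * ∑ i ∈ Finset.range (j + 1), m ^ i =
        a + m * (a * ∑ i ∈ Finset.range j, m ^ i) := by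
      simp only [Finset.sum_range_succ', pow_succ', ← Finset.mul_sum]
      ring
    rw [pow_succ', ih, mul_assoc, ← mul_assoc y, h, pow_succ' y, hsum, zpow_add]
    simp only [mul_assoc]

/-- For `p` odd, a finite `p`-group without subgroups of type `(p, p)` is cyclic. -/
theorem isCyclic_of_card_eq_prime_pow_of_commute {p : ℕ} (hp : p.Prime) (hodd : Odd p) (n : ℕ)
    (K : Type*) [Group K] [Finite K] (hcard : Nat.card K = p ^ n)
    (hK : ∀ x y : K, Commute x y → x ^ p = 1 → y ^ p = 1 → y ≠ 1 → x ∈ Subgroup.zpowers y) :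
    IsCyclic K := by
  have := Fact.mk hp
  induction n generalizing K with
  | zero =>
    have := (Nat.card_eq_one_iff_unique.1 (by simpa using hcard)).1
    infer_instance
  | succ n ih =>
    obtain ⟨M, hM⟩ := Sylow.exists_subgroup_card_pow_prime (G := K) p (n := n)
      (hcard ▸ pow_dvd_pow p n.le_succ)
    have hMcyc : IsCyclic M := ih M hM fun x y hxy hx hy hy1 => by
      obtain ⟨k, hk⟩ := hK x y (congrArg Subtype.val hxy) (congrArg Subtype.val hx)
        (congrArg Subtype.val hy) fun h => hy1 (Subtype.ext h)
      exact ⟨k, Subtype.ext (by simpa using hk)⟩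
    obtain ⟨x, rfl⟩ := (Subgroup.isCyclic_iff_exists_zpowers_eq_top M).1 hMcyc
    rw [Nat.card_zpowers] at hM
    rcases n with _ | n
    · exact isCyclic_of_prime_card (p := p) (by simpa using hcard)
    have hindex : (Subgroup.zpowers x).index = p := by
      have h := (Subgroup.zpowers x).card_mul_index
      rw [Nat.card_zpowers, hM, hcard, pow_succ _ (n + 1)] at h
      exact Nat.eq_of_mul_eq_mul_left (pow_pos hp.pos _) h
    have hnormal : (Subgroup.zpowers x).Normal := by
      apply Subgroup.normal_of_index_eq_minFac_card
      rw [hindex, hcard, hp.pow_minFac (Nat.succ_ne_zero _)]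
    obtain ⟨y, hy⟩ : ∃ y, y ∉ Subgroup.zpowers x := by
      by_contra! h
      rw [(Subgroup.eq_top_iff' _).2 h, Subgroup.index_top] at hindex
      exact hp.one_lt.ne hindex
    obtain ⟨m, hm⟩ := hnormal.conj_mem x (Subgroup.mem_zpowers x) y
    obtain ⟨k, hk⟩ : y ^ p ∈ Subgroup.zpowers x := hindex ▸ Subgroup.pow_index_mem _ y
    simp only at hm hk
    have hzpow : ∀ a : ℤ, x ^ a = 1 ↔ (p : ℤ) ^ (n + 1) ∣ a := fun a => by
      rw [← orderOf_dvd_iff_zpow_eq_one, hM, Nat.cast_pow]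
    have hconj : ∀ a : ℤ, y * x ^ a = x ^ (m * a) * y := fun a => by
      rw [zpow_mul, hm, conj_zpow, inv_mul_cancel_right]
    have hconj' : ∀ j : ℕ, y ^ j * x = x ^ (m ^ j) * y ^ j := fun j => by
      induction j with
      | zero => simp
      | succ j ihj => rw [pow_succ', mul_assoc, ihj, ← mul_assoc, hconj, ← pow_succ', mul_assoc]
    have hmp : (p : ℤ) ^ (n + 1) ∣ m ^ p - 1 := by
      have h := hconj' p
      rw [← hk, ← zpow_add_one, ← zpow_add] at h
      rw [← hzpow, show m ^ p - 1 = m ^ p + k - (k + 1) by ring, zpow_sub, ← h, mul_inv_cancel]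
    obtain ⟨h1, h2⟩ := Int.dvd_sub_one_of_pow_dvd_pow_sub_one hp hodd hmp
    by_cases hpk : (p : ℤ) ∣ k
    · exfalso
      obtain ⟨l, rfl⟩ := hpk
      have hz : (x ^ (-l) * y) ^ p = 1 := by
        rw [zpow_mul_pow_eq_of_conj_eq_zpow hconj, ← hk, ← zpow_add, hzpow]
        refine ((Int.pow_succ_dvd_geom_sum_sub hodd h1 h2).mul_left (-l)).trans (dvd_of_eq ?_)
        ring
      have hwp : (x ^ ((p : ℤ) ^ n)) ^ p = 1 := by
        rw [← zpow_natCast, ← zpow_mul, ← pow_succ, hzpow]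
      have hw1 : x ^ ((p : ℤ) ^ n) ≠ 1 := by
        rw [Ne, hzpow]
        intro h
        have := Nat.pow_dvd_pow_iff_le_right hp.one_lt |>.1 (by exact_mod_cast h)
        omega
      have hcomm : Commute (x ^ (-l) * y) (x ^ ((p : ℤ) ^ n)) := by
        refine Commute.mul_left (Commute.zpow_zpow (Commute.refl x) _ _) ?_
        have h3 : x ^ (m * (p : ℤ) ^ n - (p : ℤ) ^ n) = 1 := by
          rw [hzpow, ← sub_one_mul, pow_succ']
          exact mul_dvd_mul_right h1 _
        rw [zpow_sub, mul_inv_eq_one] at h3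
        rw [Commute, SemiconjBy, hconj, h3]
      have hmem := hK _ _ hcomm hz hwp hw1
      have hle := Subgroup.zpowers_le.2 (zpow_mem (Subgroup.mem_zpowers x) ((p : ℤ) ^ n)) hmem
      exact hy ((Subgroup.mul_mem_cancel_left _ (zpow_mem (Subgroup.mem_zpowers x) _)).1 hle)
    · refine isCyclic_of_orderOf_eq_card y ?_
      rw [hcard]
      refine orderOf_eq_prime_pow (fun h => hpk ?_) (hcard ▸ pow_card_eq_one')
      rw [pow_succ', pow_mul, ← hk, ← zpow_natCast, ← zpow_mul, hzpow, pow_succ', Nat.cast_pow] at h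
      exact (mul_dvd_mul_iff_right (pow_ne_zero n (by exact_mod_cast hp.ne_zero))).1 h

/-- If every `{p, q}`-element of order divisible by `p * q` lies in `N`, then a `p`-element
modulo `N` outside `N` commutes with no element of order `q` of `N`. -/
theorem eq_one_of_commute_of_pow_mem {G : Type*} [Group G] [Finite G] {p q : ℕ}
    (hp : p.Prime) (hq : q.Prime) (hpq : p ≠ q) {N : Subgroup G}
    (hN : ∀ g : G, p * q ∣ orderOf g →
      (∀ r : ℕ, r.Prime → r ∣ orderOf g → r = p ∨ r = q) → g ∈ N)
    {x w : G} (hxN : x ∉ N) (hxp : x ^ p ∈ N) (hw : w ∈ N) (hwq : w ^ q = 1)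
    (hxw : Commute x w) : w = 1 := by
  have := Fact.mk hp
  have := Fact.mk hq
  by_contra hw1
  obtain ⟨a, m, hm, ham⟩ := Nat.exists_eq_pow_mul_and_not_dvd (orderOf_pos x).ne' p hp.ne_one
  have hm0 : m ≠ 0 := fun h => hm (h ▸ dvd_zero p)
  have hxm : x ^ m ∉ N := fun h => by
    have hcop : IsCoprime (p : ℤ) m :=
      Nat.isCoprime_iff_coprime.2 ((Nat.Prime.coprime_iff_not_dvd hp).2 hm)
    obtain ⟨u, v, huv⟩ := hcop
    apply hxN
    rw [← zpow_one x, ← huv, zpow_add, mul_comm u, mul_comm v, zpow_mul, zpow_mul, zpow_natCast,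
      zpow_natCast]
    exact mul_mem (zpow_mem hxp _) (zpow_mem h _)
  have hord : orderOf (x ^ m) = p ^ a := by
    rw [orderOf_pow_of_dvd hm0 (ham ▸ dvd_mul_left m _), ham,
      Nat.mul_div_cancel _ (Nat.pos_of_ne_zero hm0)]
  have ha : a ≠ 0 := by
    rintro rfl
    rw [pow_zero, orderOf_eq_one_iff] at hord
    exact hxm (hord ▸ one_mem N)
  have hordw : orderOf w = q := orderOf_eq_prime hwq hw1
  have hmul : orderOf (x ^ m * w) = p ^ a * q := by
    rw [(hxw.pow_left m).orderOf_mul_eq_mul_orderOf_of_coprime, hord, hordw]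
    rw [hord, hordw]
    exact ((Nat.coprime_primes hp hq).2 hpq).pow_left a
  refine hxm ((N.mul_mem_cancel_right hw).1 (hN _ ?_ fun r hr hdvd => ?_))
  · rw [hmul]
    exact mul_dvd_mul_right (dvd_pow_self p ha) q
  · rw [hmul] at hdvd
    rcases hr.dvd_mul.1 hdvd with h | h
    · exact Or.inl ((Nat.prime_dvd_prime_iff_eq hr hp).1 (hr.dvd_of_dvd_pow h))
    · exact Or.inr ((Nat.prime_dvd_prime_iff_eq hr hq).1 h)

/-- If `N` is a nilpotent normal subgroup containing every `{p, q}`-element of order divisible by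
`p * q`, and `q` divides the order of `N`, then the Sylow `p`-subgroups of `G ⧸ N` are cyclic,
for `p` odd. -/
theorem isCyclic_sylow_quotient_of_mem {G : Type*} [Group G] [Finite G] {p q : ℕ}
    (hp : p.Prime) (hq : q.Prime) (hodd : Odd p) (hpq : p ≠ q)
    (N : Subgroup G) [N.Normal] [Group.IsNilpotent N] (hdvd : q ∣ Nat.card N)
    (hN : ∀ g : G, p * q ∣ orderOf g →
      (∀ r : ℕ, r.Prime → r ∣ orderOf g → r = p ∨ r = q) → g ∈ N)
    (T : Sylow p (G ⧸ N)) : IsCyclic T := by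
  have := Fact.mk hp
  let Z : Subgroup G := (Subgroup.center N).map N.subtype
  have hZ : ∀ z ∈ Z, z ∈ N ∧ ∀ g ∈ N, g * z = z * g := by
    rintro _ ⟨z, hz, rfl⟩
    exact ⟨z.2, fun g hg => congrArg Subtype.val (Subgroup.mem_center_iff.1 hz ⟨g, hg⟩)⟩
  let _ : CommGroup Z :=
    { (inferInstance : Group Z) with
      mul_comm := fun a b => Subtype.ext ((hZ b b.2).2 a (hZ a a.2).1) }
  let φ : G ⧸ N →* MulAut Z := QuotientGroup.lift N MulAut.conjNormal fun g hg => by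
    ext z
    rw [MulAut.conjNormal_apply, (hZ z z.2).2 g hg, mul_inv_cancel_right, MulAut.one_apply]
  have hfree : ∀ z : T, z ^ p = 1 → z ≠ 1 → ∀ w : Z, w ^ q = 1 →
      (φ.comp (T : Subgroup (G ⧸ N)).subtype) z w = w → w = 1 := by
    rintro ⟨z, hzT⟩ hzp hz1 w hw hzw
    obtain ⟨x, rfl⟩ := QuotientGroup.mk_surjective z
    have hxw : x * w * x⁻¹ = w := congrArg Subtype.val hzw
    refine Subtype.ext (eq_one_of_commute_of_pow_mem hp hq hpq hN (x := x) ?_ ?_ (hZ w w.2).1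
      (congrArg Subtype.val hw) (mul_inv_eq_iff_eq_mul.1 hxw))
    · exact fun hx => hz1 (Subtype.ext ((QuotientGroup.eq_one_iff x).2 hx))
    · exact (QuotientGroup.eq_one_iff _).1 (congrArg Subtype.val hzp)
  obtain ⟨v, hvZ, hvq, hv1⟩ := exists_mem_center_pow_prime_eq_one hq hdvd
  obtain ⟨n, hn⟩ := IsPGroup.iff_card.1 T.isPGroup'
  refine isCyclic_of_card_eq_prime_pow_of_commute hp hodd n T hn fun x y hxy hx hy hy1 => ?_
  refine mem_zpowers_of_commute_of_fixedPointFree (φ.comp (T : Subgroup (G ⧸ N)).subtype) hp hq hpq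
    hfree (v := ⟨v, v, hvZ, rfl⟩) ?_ ?_ hxy hx hy hy1
  · exact Subtype.ext (congrArg N.subtype hvq)
  · exact fun h => hv1 (Subtype.ext (congrArg Z.subtype h))

/-- If `OmegaBad p q G`, then `p * q` divides the order of the Frattini subgroup. -/
theorem OmegaBad.mul_dvd_card_frattini {G : Type*} [Group G] [Finite G] {p q : ℕ}
    (hp : p.Prime) (hq : q.Prime) (hbad : OmegaBad p q G) : p * q ∣ Nat.card (frattini G) := by
  obtain ⟨⟨g, hg⟩, hmem⟩ := hbad
  have hord := orderOf_pow_orderOf_div (orderOf_pos g).ne' hg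
  have h := hmem (g ^ (orderOf g / (p * q))) ⟨hord.symm.dvd, fun r hr hdvd => by
    rw [hord, hr.dvd_mul, Nat.prime_dvd_prime_iff_eq hr hp, Nat.prime_dvd_prime_iff_eq hr hq]
      at hdvd
    exact hdvd⟩
  rw [← hord]
  exact Subgroup.orderOf_dvd_natCard _ h

/-- Let `p, q` be distinct odd primes and `G` a finite group of minimal order subject to
`Ω_{p,q}(G) ≠ ∅` and `Ω**_{p,q}(G) = ∅`.  Then the Sylow `p`-subgroups and the Sylow
`q`-subgroups of `G/Frat(G)` are cyclic. -/
theorem minimal_omegaBad_sylow_cyclic.{u}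
    (G : Type u) [Group G] [Finite G] (p q : ℕ)
    (hp : p.Prime) (hq : q.Prime) (hpodd : Odd p) (hqodd : Odd q) (hpq : p ≠ q)
    (hbad : OmegaBad p q G)
    (hmin : ∀ (H : Type u) [Group H] [Finite H], OmegaBad p q H → Nat.card G ≤ Nat.card H) :
    (∀ T : Sylow p (G ⧸ frattini G), IsCyclic T) ∧
      ∀ T : Sylow q (G ⧸ frattini G), IsCyclic T := by
  have hdvd := hbad.mul_dvd_card_frattini hp hq
  have := frattini_nilpotent (G := G)
  exact ⟨isCyclic_sylow_quotient_of_mem hp hq hpodd hpq _ (dvd_of_mul_left_dvd hdvd)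
      fun g hg hr => hbad.2 g ⟨hg, hr⟩,
    isCyclic_sylow_quotient_of_mem hq hp hqodd hpq.symm _ (dvd_of_mul_right_dvd hdvd)
      fun g hg hr => hbad.2 g ⟨mul_comm q p ▸ hg, fun r hp' hd => (hr r hp' hd).symm⟩⟩
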